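/- arXiv:1709.01098 — 8 statements merged into one kernel-verified Lean document; each statement's English description precedes it below -/
import Mathlib

section
/- If a contextuality scenario Γ satisfies structural Specker's principle, i.e., every clique of its orthogonality graph O(Γ) is contained in some hyperedge of Γ, then CE¹(Γ) = G(Γ): every probabilistic model on Γ satisfies consistent exclusivity. -/
/-- Two vertices of a contextuality scenario (with hyperedge set `E`) are orthogonal
(exclusive) if they are distinct and lie in a common hyperedge. -/
def Orth {V : Type*} (E : Set (Finset V)) (v w : V) : Prop :=
  v ≠ w ∧ ∃ e ∈ E, v ∈ e ∧ w ∈ e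

/-- A clique of the orthogonality graph `O(Γ)`: a set of pairwise orthogonal vertices. -/
def IsOrthClique {V : Type*} (E : Set (Finset V)) (c : Finset V) : Prop :=
  ∀ v ∈ c, ∀ w ∈ c, v ≠ w → Orth E v w

/-- A probabilistic model on a contextuality scenario: `p : V → [0,1]` with
`∑_{v ∈ e} p v = 1` for each hyperedge `e`.  The set of all of these is `G(Γ)`. -/
def IsProbModel {V : Type*} (E : Set (Finset V)) (p : V → ℝ) : Prop :=
  (∀ v, 0 ≤ p v ∧ p v ≤ 1) ∧ ∀ e ∈ E, ∑ v ∈ e, p v = 1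

/-- Membership in `CE¹(Γ)`: a probabilistic model whose sum over every clique of the
orthogonality graph is at most `1` (consistent exclusivity). -/
def CE1Model {V : Type*} (E : Set (Finset V)) (p : V → ℝ) : Prop :=
  IsProbModel E p ∧ ∀ c : Finset V, IsOrthClique E c → ∑ v ∈ c, p v ≤ 1

/-- If a contextuality scenario `Γ` satisfies structural Specker's
principle — every clique of its orthogonality graph `O(Γ)` is contained in some
hyperedge of `Γ` — then `CE¹(Γ) = G(Γ)`: every probabilistic model on `Γ` satisfies
consistent exclusivity. -/
theorem stmt1 {V : Type*} (E : Set (Finset V)) (hcover : ∀ v : V, ∃ e ∈ E, v ∈ e)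
    (hSSP : ∀ c : Finset V, IsOrthClique E c → ∃ e ∈ E, c ⊆ e) :
    ∀ p : V → ℝ, IsProbModel E p → CE1Model E p := by
  intro p hp
  refine ⟨hp, fun c hc => ?_⟩
  obtain ⟨e, he, hce⟩ := hSSP c hc
  exact (Finset.sum_le_sum_of_subset_of_nonneg hce fun v _ _ => (hp.1 v).1).trans_eq (hp.2 e he)
end

section
/- Let α, α*, β, Corr₀, R, μ_det, μ_ind be real numbers with α < α*, β ≤ 1, μ_det ≥ 0, μ_ind ≥ 0, μ_det + μ_ind = 1, Corr₀ ≤ μ_det + β·μ_ind, and R ≤ α·μ_det + α*·μ_ind. Then Corr₀ ≤ 1 − (1 − β)·(R − α)/(α* − α). -/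
/-- The elimination lemma behind the noise-robust noncontextuality
inequality: if `μ_det, μ_ind ≥ 0` with `μ_det + μ_ind = 1`, `β ≤ 1`, `α < α*`,
`Corr₀ ≤ μ_det + β·μ_ind` and `R ≤ α·μ_det + α*·μ_ind`, then
`Corr₀ ≤ 1 − (1 − β)·(R − α)/(α* − α)`. -/
theorem stmt4 (α αs β Corr₀ R μdet μind : ℝ)
    (hαs : α < αs) (hβ : β ≤ 1) (hμdet : 0 ≤ μdet) (hμind : 0 ≤ μind)
    (hsum : μdet + μind = 1)
    (hCorr : Corr₀ ≤ μdet + β * μind)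
    (hR : R ≤ α * μdet + αs * μind) :
    Corr₀ ≤ 1 - (1 - β) * (R - α) / (αs - α) := by
  obtain rfl : μdet = 1 - μind := by linarith
  have hd : 0 < αs - α := sub_pos.mpr hαs
  have hR' : R - α ≤ μind * (αs - α) := by linarith
  have hbound : (1 - β) * (R - α) / (αs - α) ≤ (1 - β) * μind := by
    rw [div_le_iff₀ hd, mul_assoc]
    exact mul_le_mul_of_nonneg_left hR' (sub_nonneg.mpr hβ)
  linarith
end

section
/- Let α, α*, β, Corr₀, Corr₁, R, μ_det, μ_ind, p₀ be real numbers with α < α*, β ≤ 1, μ_det ≥ 0, μ_ind ≥ 0, μ_det + μ_ind = 1, Corr₀ ≤ μ_det + β·μ_ind, R ≤ α·μ_det + α*·μ_ind, Corr₁ ≤ 1, and 0 ≤ p₀ ≤ 1. If Corr = p₀·Corr₀ + (1 − p₀)·Corr₁, then Corr + p₀·(1 − β)·(R − α)/(α* − α) ≤ 1. -/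
/-- The general noise-robust noncontextuality inequality (tradeoff
between `Corr`, `R` and `p₀`): under the stated constraints on the weights
`μ_det, μ_ind`, the conditional correlations `Corr₀, Corr₁`, the Bell-KS value `R`
and the source-outcome probability `p₀`, if `Corr = p₀·Corr₀ + (1 − p₀)·Corr₁`, then
`Corr + p₀·(1 − β)·(R − α)/(α* − α) ≤ 1`. -/
theorem stmt5 (α αs β Corr₀ Corr₁ Corr R μdet μind p₀ : ℝ)
    (hαs : α < αs) (hβ : β ≤ 1) (hμdet : 0 ≤ μdet) (hμind : 0 ≤ μind)
    (hsum : μdet + μind = 1)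
    (hCorr₀ : Corr₀ ≤ μdet + β * μind)
    (hR : R ≤ α * μdet + αs * μind)
    (hCorr₁ : Corr₁ ≤ 1)
    (hp₀0 : 0 ≤ p₀) (hp₀1 : p₀ ≤ 1)
    (hCorr : Corr = p₀ * Corr₀ + (1 - p₀) * Corr₁) :
    Corr + p₀ * (1 - β) * (R - α) / (αs - α) ≤ 1 := by
  obtain rfl : μdet = 1 - μind := by linarith
  have hle : (R - α) / (αs - α) ≤ μind := by
    rw [div_le_iff₀ (sub_pos.mpr hαs)]
    linarith
  have hterm : p₀ * (1 - β) * ((R - α) / (αs - α)) ≤ p₀ * (1 - β) * μind :=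
    mul_le_mul_of_nonneg_left hle (mul_nonneg hp₀0 (sub_nonneg.mpr hβ))
  have h₀ : p₀ * Corr₀ ≤ p₀ * (1 - μind + β * μind) :=
    mul_le_mul_of_nonneg_left hCorr₀ hp₀0
  have h₁ : (1 - p₀) * Corr₁ ≤ (1 - p₀) * 1 :=
    mul_le_mul_of_nonneg_left hCorr₁ (sub_nonneg.mpr hp₀1)
  rw [hCorr, mul_div_assoc]
  linarith
end

section
/- Let α, α*, β, Corr, R, P_det, P_ind, p₀ be real numbers with α < α*, β ≤ 1, P_det ≥ 0, P_ind ≥ 0, P_det + P_ind = 1, 0 ≤ p₀ ≤ 1, Corr ≤ P_det + β·P_ind, and R ≤ α·P_det + α*·P_ind. Then Corr + p₀·(1 − β)·(R − α)/(α* − α) ≤ 1. (Consequently, probabilistic models realized by trivial POVMs, whose Corr and R values always admit such a decomposition over deterministic and indeterministic extremal points, can never violate the noise-robust noncontextuality inequality.) -/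
/-- Probabilistic models realized by trivial POVMs never violate the
noise-robust noncontextuality inequality: if `Corr` and `R` admit a decomposition over
deterministic and indeterministic extremal points with weights `P_det, P_ind ≥ 0`,
`P_det + P_ind = 1`, so that `Corr ≤ P_det + β·P_ind` and `R ≤ α·P_det + α*·P_ind`,
then `Corr + p₀·(1 − β)·(R − α)/(α* − α) ≤ 1` for every `p₀ ∈ [0,1]`. -/
theorem stmt6 (α αs β Corr R Pdet Pind p₀ : ℝ)
    (hαs : α < αs) (hβ : β ≤ 1) (hPdet : 0 ≤ Pdet) (hPind : 0 ≤ Pind)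
    (hsum : Pdet + Pind = 1)
    (hp₀0 : 0 ≤ p₀) (hp₀1 : p₀ ≤ 1)
    (hCorr : Corr ≤ Pdet + β * Pind)
    (hR : R ≤ α * Pdet + αs * Pind) :
    Corr + p₀ * (1 - β) * (R - α) / (αs - α) ≤ 1 := by
  obtain rfl : Pdet = 1 - Pind := by linarith
  have hquot : (R - α) / (αs - α) ≤ Pind := by
    rw [div_le_iff₀ (sub_pos.mpr hαs)]
    linarith
  have hβ' : 0 ≤ 1 - β := sub_nonneg.mpr hβ
  have hterm : p₀ * (1 - β) * (R - α) / (αs - α) ≤ (1 - β) * Pind :=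
    calc p₀ * (1 - β) * (R - α) / (αs - α)
        = p₀ * (1 - β) * ((R - α) / (αs - α)) := mul_div_assoc _ _ _
      _ ≤ p₀ * (1 - β) * Pind := by gcongr
      _ ≤ 1 * (1 - β) * Pind := by gcongr
      _ = (1 - β) * Pind := by rw [one_mul]
  linarith
end

section
/- For all real numbers x₁, x₂, x₃ ∈ [0,1] with x₁ + x₂ + x₃ = 3/2, one has max(x₁, 1−x₁) + max(x₂, 1−x₂) + max(x₃, 1−x₃) ≤ 5/2, and the bound is attained (e.g., at x₁ = 1, x₂ = 1/2, x₃ = 0). -/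
/-- For all `x₁, x₂, x₃ ∈ [0,1]` with `x₁ + x₂ + x₃ = 3/2` one has
`max(x₁,1−x₁) + max(x₂,1−x₂) + max(x₃,1−x₃) ≤ 5/2`, and the bound is attained at
`x₁ = 1, x₂ = 1/2, x₃ = 0`. -/
theorem stmt7 :
    (∀ x₁ x₂ x₃ : ℝ, x₁ ∈ Set.Icc (0:ℝ) 1 → x₂ ∈ Set.Icc (0:ℝ) 1 →
      x₃ ∈ Set.Icc (0:ℝ) 1 → x₁ + x₂ + x₃ = 3/2 →
      max x₁ (1 - x₁) + max x₂ (1 - x₂) + max x₃ (1 - x₃) ≤ 5/2) ∧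
    ((1:ℝ) ∈ Set.Icc (0:ℝ) 1 ∧ (1/2:ℝ) ∈ Set.Icc (0:ℝ) 1 ∧ (0:ℝ) ∈ Set.Icc (0:ℝ) 1 ∧
      (1:ℝ) + 1/2 + 0 = 3/2 ∧
      max (1:ℝ) (1 - 1) + max (1/2:ℝ) (1 - 1/2) + max (0:ℝ) (1 - 0) = 5/2) := by
  refine ⟨?_, by norm_num⟩
  rintro x₁ x₂ x₃ ⟨h₁, h₁'⟩ ⟨h₂, h₂'⟩ ⟨h₃, h₃'⟩ hsum
  rcases max_choice x₁ (1 - x₁) with e₁ | e₁ <;>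
  rcases max_choice x₂ (1 - x₂) with e₂ | e₂ <;>
  rcases max_choice x₃ (1 - x₃) with e₃ | e₃ <;>
  rw [e₁, e₂, e₃] <;> linarith
end

section
/- Let Λ be a finite set, ν : Λ → [0,∞) with Σ_{λ∈Λ} ν(λ) = 1, and for each i ∈ {1,2,3} let ξ_i : Λ → [0,1] and μ_i : Λ → [0,1]. Suppose ξ₁(λ) + ξ₂(λ) + ξ₃(λ) = 3/2 for every λ ∈ Λ. Then (1/3)·Σ_{i=1}^{3} Σ_{λ∈Λ} ν(λ)·[ξ_i(λ)·μ_i(λ) + (1 − ξ_i(λ))·(1 − μ_i(λ))] ≤ 5/6. -/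
/-- A binary guess with bias `m` agrees with a bit of bias `x` at most as often as the
best deterministic guess. -/
theorem agreement_le_max {x m : ℝ} (hm : m ∈ Set.Icc (0:ℝ) 1) :
    x * m + (1 - x) * (1 - m) ≤ max x (1 - x) := by
  have h₁ := mul_le_mul_of_nonneg_right (le_max_left x (1 - x)) hm.1
  have h₂ := mul_le_mul_of_nonneg_right (le_max_right x (1 - x)) (sub_nonneg.2 hm.2)
  linarith

/-- Three numbers in `[0,1]` with sum `3/2` have total best-guess probability at most `5/2`. -/
theorem sum_max_one_sub_le {x y z : ℝ} (hx : x ∈ Set.Icc (0:ℝ) 1) (hy : y ∈ Set.Icc (0:ℝ) 1)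
    (hz : z ∈ Set.Icc (0:ℝ) 1) (h : x + y + z = 3/2) :
    max x (1 - x) + max y (1 - y) + max z (1 - z) ≤ 5/2 := by
  obtain ⟨hx0, hx1⟩ := hx
  obtain ⟨hy0, hy1⟩ := hy
  obtain ⟨hz0, hz1⟩ := hz
  rcases max_choice x (1 - x) with ex | ex <;> rcases max_choice y (1 - y) with ey | ey <;>
    rcases max_choice z (1 - z) with ez | ez <;> rw [ex, ey, ez] <;> linarith

/-- The fair-coin-flip noncontextuality inequality `Corr_fcf ≤ 5/6`:
in a noncontextual ontological model with finite ontic state space `Λ`, common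
distribution `ν` over ontic states, response functions `ξ i : Λ → [0,1]` satisfying
the fair-coin-flip constraint `ξ₁(l) + ξ₂(l) + ξ₃(l) = 3/2` for every ontic state `l`,
and source distributions `μ i : Λ → [0,1]`, the source–measurement correlation
`(1/3)·Σᵢ Σ_l ν(l)·[ξᵢ(l)·μᵢ(l) + (1−ξᵢ(l))·(1−μᵢ(l))]` is at most `5/6`. -/
theorem stmt8 {Λ : Type*} [Fintype Λ]
    (ν : Λ → ℝ) (hν0 : ∀ l : Λ, 0 ≤ ν l) (hν1 : ∑ l : Λ, ν l = 1)
    (ξ μ : Fin 3 → Λ → ℝ)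
    (hξ : ∀ (i : Fin 3) (l : Λ), ξ i l ∈ Set.Icc (0:ℝ) 1)
    (hμ : ∀ (i : Fin 3) (l : Λ), μ i l ∈ Set.Icc (0:ℝ) 1)
    (hsum : ∀ l : Λ, ξ 0 l + ξ 1 l + ξ 2 l = 3/2) :
    (1/3 : ℝ) * ∑ i : Fin 3, ∑ l : Λ,
        ν l * (ξ i l * μ i l + (1 - ξ i l) * (1 - μ i l)) ≤ 5/6 := by
  have key (l : Λ) : ∑ i : Fin 3, (ξ i l * μ i l + (1 - ξ i l) * (1 - μ i l)) ≤ 5/2 := by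
    rw [Fin.sum_univ_three]
    linarith [agreement_le_max (x := ξ 0 l) (hμ 0 l), agreement_le_max (x := ξ 1 l) (hμ 1 l),
      agreement_le_max (x := ξ 2 l) (hμ 2 l),
      sum_max_one_sub_le (hξ 0 l) (hξ 1 l) (hξ 2 l) (hsum l)]
  have total : ∑ i : Fin 3, ∑ l : Λ,
      ν l * (ξ i l * μ i l + (1 - ξ i l) * (1 - μ i l)) ≤ 5/2 := by
    rw [Finset.sum_comm]
    calc _ ≤ ∑ l : Λ, ν l * (5/2) := Finset.sum_le_sum fun l _ => by
          rw [← Finset.mul_sum]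
          exact mul_le_mul_of_nonneg_left (key l) (hν0 l)
      _ = 5/2 := by rw [← Finset.sum_mul, hν1, one_mul]
  linarith
end

section
/- For i = 1,…,5 let φ_i = 4πi/5, let c = 5^{-1/4} and s = √(1 − 1/√5), and define the vectors l_i = (s·cos φ_i, s·sin φ_i, c) ∈ ℝ³ and ψ = (0,0,1). Then each l_i is a unit vector, ⟨l_i, l_{i+1}⟩ = 0 for all i (indices modulo 5, so l₆ = l₁), and Σ_{i=1}^{5} ⟨l_i, ψ⟩² = √5. -/
/-- The KCBS vectors `l_i = (s·cos φ_i, s·sin φ_i, c) ∈ ℝ³` with `φ_i = 4πi/5`,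
`c = 5^{-1/4}` and `s = √(1 − 1/√5)`, indexed cyclically by `i ∈ ℤ₅`. -/
noncomputable def kcbsVec (i : ZMod 5) : Fin 3 → ℝ :=
  ![Real.sqrt (1 - 1 / Real.sqrt 5) * Real.cos (4 * Real.pi * (i.val : ℝ) / 5),
    Real.sqrt (1 - 1 / Real.sqrt 5) * Real.sin (4 * Real.pi * (i.val : ℝ) / 5),
    (5 : ℝ) ^ (-(1/4) : ℝ)]

/-- The KCBS handle state `ψ = (0,0,1)`. -/
noncomputable def kcbsHandle : Fin 3 → ℝ := ![0, 0, 1]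

theorem rpow_neg_quarter_sq : ((5 : ℝ) ^ (-(1/4) : ℝ)) ^ 2 = 1 / √5 := by
  rw [← Real.rpow_natCast, ← Real.rpow_mul (by norm_num), Real.sqrt_eq_rpow,
    one_div ((5 : ℝ) ^ (1 / 2 : ℝ)), ← Real.rpow_neg (by norm_num)]
  norm_num

theorem sq_sqrt_one_sub_inv_sqrt_five : √(1 - 1 / √5) ^ 2 = 1 - 1 / √5 := by
  refine Real.sq_sqrt (sub_nonneg.2 ?_)
  rw [div_le_one (by positivity)]
  exact Real.one_le_sqrt.2 (by norm_num)

theorem cos_four_pi_div_five : Real.cos (4 * Real.pi / 5) = -((1 + √5) / 4) := by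
  rw [← Real.cos_pi_div_five, ← Real.cos_pi_sub]
  congr 1
  ring

theorem exists_kcbs_angle_succ (i : ZMod 5) : ∃ n : ℤ,
    4 * Real.pi * ((i + 1).val : ℝ) / 5 =
      4 * Real.pi * (i.val : ℝ) / 5 + 4 * Real.pi / 5 + n * (2 * Real.pi) := by
  have h : ((i + 1).val : ℝ) + 5 * ((i.val + 1) / 5 : ℕ) = i.val + 1 := by
    rw [ZMod.val_add, ZMod.val_one'' (by norm_num)]
    exact_mod_cast Nat.mod_add_div _ _
  refine ⟨-2 * ((i.val + 1) / 5 : ℕ), ?_⟩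
  rw [Int.cast_mul, Int.cast_natCast, Int.cast_neg, Int.cast_ofNat]
  linear_combination 4 * Real.pi / 5 * h

theorem cos_kcbs_angle_sub (i : ZMod 5) :
    Real.cos (4 * Real.pi * (i.val : ℝ) / 5) * Real.cos (4 * Real.pi * ((i + 1).val : ℝ) / 5) +
      Real.sin (4 * Real.pi * (i.val : ℝ) / 5) * Real.sin (4 * Real.pi * ((i + 1).val : ℝ) / 5) =
      -((1 + √5) / 4) := by
  obtain ⟨n, hn⟩ := exists_kcbs_angle_succ i
  rw [hn, Real.cos_add_int_mul_two_pi, Real.sin_add_int_mul_two_pi, Real.cos_add, Real.sin_add,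
    ← cos_four_pi_div_five]
  linear_combination Real.cos (4 * Real.pi / 5) *
    Real.sin_sq_add_cos_sq (4 * Real.pi * (i.val : ℝ) / 5)

/-- Each KCBS vector is a unit vector, cyclically adjacent KCBS
vectors are orthogonal (`⟨l_i, l_{i+1}⟩ = 0`, indices mod 5), and
`Σ_{i=1}^{5} ⟨l_i, ψ⟩² = √5`. -/
theorem stmt10 :
    (∀ i : ZMod 5, ∑ k : Fin 3, kcbsVec i k * kcbsVec i k = 1) ∧
    (∀ i : ZMod 5, ∑ k : Fin 3, kcbsVec i k * kcbsVec (i + 1) k = 0) ∧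
    (∑ i : ZMod 5, (∑ k : Fin 3, kcbsVec i k * kcbsHandle k) ^ 2 = Real.sqrt 5) := by
  have hc := rpow_neg_quarter_sq
  have hs := sq_sqrt_one_sub_inv_sqrt_five
  have h5 : √5 ^ 2 = (5 : ℝ) := Real.sq_sqrt (by norm_num)
  have h0 : (√5 : ℝ) ≠ 0 := by positivity
  refine ⟨fun i ↦ ?_, fun i ↦ ?_, ?_⟩
  · simp only [kcbsVec, Fin.sum_univ_three, Matrix.cons_val]
    linear_combination √(1 - 1 / √5) ^ 2 *
      Real.sin_sq_add_cos_sq (4 * Real.pi * (i.val : ℝ) / 5) + hs + hc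
  · simp only [kcbsVec, Fin.sum_univ_three, Matrix.cons_val]
    have h : (1 - 1 / √5) * -((1 + √5) / 4) + 1 / √5 = 0 := by
      field_simp
      linear_combination -h5
    linear_combination √(1 - 1 / √5) ^ 2 * cos_kcbs_angle_sub i
      - (1 + √5) / 4 * hs + hc + h
  · simp only [kcbsVec, kcbsHandle, Fin.sum_univ_three, Matrix.cons_val, mul_zero, zero_add,
      mul_one, hc, Finset.sum_const, Finset.card_univ, ZMod.card, nsmul_eq_mul]
    push_cast
    field_simp
    exact h5.symm
end

section
/- Let l₁,…,l₅ and ψ be the KCBS vectors in ℝ³ (l_i = (s·cos(4πi/5), s·sin(4πi/5), c) with c = 5^{-1/4}, s = √(1 − 1/√5), ψ = (0,0,1)), regarded as unit vectors in ℂ³ with associated rank-one projectors |l_i⟩⟨l_i| and |ψ⟩⟨ψ|. Then for all real r₁, r₂: Σ_{i=1}^{5} Tr[(r₂·|l_i⟩⟨l_i| + ((1−r₂)/3)·I)·(r₁·|ψ⟩⟨ψ| + ((1−r₁)/3)·I)] = r₁·r₂·√5 + (5/3)·(1 − r₁·r₂). -/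
open Matrix

/-- The rank-one projector `|v⟩⟨v|` associated to a real unit vector `v ∈ ℝ³`,
regarded as a 3×3 complex matrix. -/
noncomputable def projOf (v : Fin 3 → ℝ) : Matrix (Fin 3) (Fin 3) ℂ :=
  Matrix.of fun a b => ((v a * v b : ℝ) : ℂ)

theorem trace_projOf (v : Fin 3 → ℝ) : (projOf v).trace = ((v ⬝ᵥ v : ℝ) : ℂ) := by
  simp [projOf, Matrix.trace, dotProduct]

theorem trace_projOf_mul_projOf (v w : Fin 3 → ℝ) :
    (projOf v * projOf w).trace = (((v ⬝ᵥ w) ^ 2 : ℝ) : ℂ) := by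
  simp only [projOf, Matrix.trace, Matrix.diag_apply, Matrix.mul_apply, Matrix.of_apply,
    dotProduct, Fin.sum_univ_three]
  push_cast
  ring

/-- The trace of the product of two depolarized rank-one projectors. -/
theorem trace_depolarized_mul_depolarized {v w : Fin 3 → ℝ} (hv : v ⬝ᵥ v = 1)
    (hw : w ⬝ᵥ w = 1) (r₁ r₂ : ℝ) :
    (((r₂ : ℂ) • projOf v + (((1 - r₂ : ℝ) : ℂ) / 3) • (1 : Matrix (Fin 3) (Fin 3) ℂ)) *
        ((r₁ : ℂ) • projOf w
          + (((1 - r₁ : ℝ) : ℂ) / 3) • (1 : Matrix (Fin 3) (Fin 3) ℂ))).trace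
      = ((r₁ * r₂ * (v ⬝ᵥ w) ^ 2 + (1 - r₁ * r₂) / 3 : ℝ) : ℂ) := by
  simp only [add_mul, mul_add, smul_mul_assoc, mul_smul_comm, one_mul, mul_one,
    Matrix.trace_add, Matrix.trace_smul, trace_projOf, trace_projOf_mul_projOf, hv, hw,
    Matrix.trace_one, Fintype.card_fin, smul_eq_mul]
  push_cast
  ring

theorem kcbs_height_sq : ((5 : ℝ) ^ (-(1/4) : ℝ)) ^ 2 = 1 / Real.sqrt 5 := by
  rw [← Real.rpow_natCast, ← Real.rpow_mul (by norm_num), Real.sqrt_eq_rpow,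
    one_div ((5 : ℝ) ^ _), ← Real.rpow_neg (by norm_num)]
  norm_num

theorem kcbsVec_dotProduct_self (i : ZMod 5) : kcbsVec i ⬝ᵥ kcbsVec i = 1 := by
  have hs : Real.sqrt (1 - 1 / Real.sqrt 5) ^ 2 = 1 - 1 / Real.sqrt 5 := by
    refine Real.sq_sqrt (sub_nonneg.2 ?_)
    rw [div_le_one (by positivity)]
    exact Real.one_le_sqrt.2 (by norm_num)
  simp only [kcbsVec, dotProduct, Fin.sum_univ_three, Matrix.cons_val]
  linear_combination hs + kcbs_height_sq + Real.sqrt (1 - 1 / Real.sqrt 5) ^ 2 *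
    Real.sin_sq_add_cos_sq (4 * Real.pi * (i.val : ℝ) / 5)

theorem kcbsVec_dotProduct_kcbsHandle_sq (i : ZMod 5) :
    (kcbsVec i ⬝ᵥ kcbsHandle) ^ 2 = 1 / Real.sqrt 5 := by
  simpa [kcbsVec, kcbsHandle, dotProduct, Fin.sum_univ_three] using kcbs_height_sq

theorem kcbsHandle_dotProduct_self : kcbsHandle ⬝ᵥ kcbsHandle = 1 := by
  simp [kcbsHandle, dotProduct, Fin.sum_univ_three]

/-- The value of the KCBS expression in the depolarized KCBS scenario:
`Σ_{i=1}^{5} Tr[(r₂|l_i⟩⟨l_i| + ((1−r₂)/3)I)·(r₁|ψ⟩⟨ψ| + ((1−r₁)/3)I)]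
 = r₁r₂√5 + (5/3)(1 − r₁r₂)` for all real `r₁, r₂`. -/
theorem stmt17 (r₁ r₂ : ℝ) :
    ∑ i : ZMod 5,
      (((r₂ : ℂ) • projOf (kcbsVec i)
          + (((1 - r₂ : ℝ) : ℂ) / 3) • (1 : Matrix (Fin 3) (Fin 3) ℂ)) *
        ((r₁ : ℂ) • projOf kcbsHandle
          + (((1 - r₁ : ℝ) : ℂ) / 3) • (1 : Matrix (Fin 3) (Fin 3) ℂ))).trace
      = ((r₁ * r₂ * Real.sqrt 5 + (5/3) * (1 - r₁ * r₂) : ℝ) : ℂ) := by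
  simp only [trace_depolarized_mul_depolarized (kcbsVec_dotProduct_self _)
    kcbsHandle_dotProduct_self, kcbsVec_dotProduct_kcbsHandle_sq, Finset.sum_const,
    Finset.card_univ, ZMod.card, nsmul_eq_mul]
  rw [← Complex.ofReal_natCast, ← Complex.ofReal_mul, Complex.ofReal_inj]
  push_cast
  linear_combination r₁ * r₂ * Real.div_sqrt (x := 5)
end
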